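/- For the cycle C_n on n ≥ 3 vertices, the eigenvalues of R^L(C_n) (viewed as a complex matrix), counted with multiplicity, are exactly the numbers (n² − 1)/6 − g(ω^k) for k = 0, 1, …, n−1, where ω = e^{2πi/n} and g(λ) = Σ_{j=1}^{n−1} (j(n−j)/n) λ^j; similarly the eigenvalues of R^Q(C_n) are (n² − 1)/6 + g(ω^k) for k = 0, 1, …, n−1. -/

import Mathlib

open Matrix Polynomial BigOperators

/-- `Ldag` is the Moore–Penrose inverse of `L`: `L Ldag L = L`, `Ldag L Ldag = Ldag`,
and both `L Ldag` and `Ldag L` are symmetric. -/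
def IsMoorePenroseInv {V : Type*} [Fintype V] (L Ldag : Matrix V V ℝ) : Prop :=
  L * Ldag * L = L ∧ Ldag * L * Ldag = Ldag ∧
    (L * Ldag)ᵀ = L * Ldag ∧ (Ldag * L)ᵀ = Ldag * L

/-- The resistance distance between vertices `i` and `j`, computed from the
Moore–Penrose inverse `Ldag` of the Laplacian: `r(i,j) = Ldag i i + Ldag j j - 2 Ldag i j`. -/
def resDist {V : Type*} (Ldag : Matrix V V ℝ) (i j : V) : ℝ :=
  Ldag i i + Ldag j j - 2 * Ldag i j

/-- The resistance distance matrix `R(G)`. -/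
def resMatrix {V : Type*} [DecidableEq V] (Ldag : Matrix V V ℝ) : Matrix V V ℝ :=
  Matrix.of fun i j => if i = j then 0 else resDist Ldag i j

/-- The resistance transmission `RTr(v) = ∑ u, r(u,v)` of a vertex `v`. -/
def resTrans {V : Type*} [Fintype V] (Ldag : Matrix V V ℝ) (v : V) : ℝ :=
  ∑ u, resDist Ldag u v

/-- The resistance Laplacian matrix `R^L = Diag(RTr) - R`. -/
def resLap {V : Type*} [Fintype V] [DecidableEq V] (Ldag : Matrix V V ℝ) : Matrix V V ℝ :=
  Matrix.diagonal (resTrans Ldag) - resMatrix Ldag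

/-- The resistance signless Laplacian matrix `R^Q = Diag(RTr) + R`. -/
def resSignlessLap {V : Type*} [Fintype V] [DecidableEq V] (Ldag : Matrix V V ℝ) :
    Matrix V V ℝ :=
  Matrix.diagonal (resTrans Ldag) + resMatrix Ldag

instance {V W : Type*} : DecidableRel (completeBipartiteGraph V W).Adj := fun v w => by
  simp only [completeBipartiteGraph_adj]
  infer_instance

theorem mp_symm {V : Type*} [Fintype V] {L X : Matrix V V ℝ} (hL : Lᵀ = L)
    (h : IsMoorePenroseInv L X) : Xᵀ = X := by
  obtain ⟨h1, h2, h3, h4⟩ := h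
  have e1 : L * Xᵀ = X * L := by rw [← h4, transpose_mul, hL]
  have e2 : Xᵀ * L = L * X := by rw [← h3, transpose_mul, hL]
  have e0 : L * Xᵀ * L = L := by
    have := congrArg transpose h1
    simpa [transpose_mul, hL, Matrix.mul_assoc] using this
  have e3 : L * X = X * L := by
    have a : L * X = (X * L) * (L * X) := by
      rw [← e1, ← Matrix.mul_assoc, e0]
    have b : (L * X)ᵀ = ((X * L) * (L * X))ᵀ := congrArg transpose a
    rw [transpose_mul (X * L), h3, h4] at b
    rw [b, ← e1, ← Matrix.mul_assoc, h1]
  have e4 : Xᵀ * L * Xᵀ = Xᵀ := by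
    have := congrArg transpose h2
    simpa [transpose_mul, hL, Matrix.mul_assoc] using this
  calc Xᵀ = Xᵀ * L * Xᵀ := e4.symm
    _ = X * L * Xᵀ := by rw [e2, e3]
    _ = X * L * X := by rw [Matrix.mul_assoc, e1, ← e3, ← Matrix.mul_assoc, e3]
    _ = X := h2

theorem resDist_of_solve {V : Type*} [Fintype V] [DecidableEq V] {L X : Matrix V V ℝ}
    (hL : Lᵀ = L) (h : IsMoorePenroseInv L X) (i j : V) (y : V → ℝ)
    (hy : L *ᵥ y = Pi.single i 1 - Pi.single j 1) : resDist X i j = y i - y j := by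
  have hs := mp_symm hL h
  have hs' : X j i = X i j := by
    conv_lhs => rw [← hs]
    rfl
  have k1 : (L *ᵥ y) ⬝ᵥ (X *ᵥ (L *ᵥ y)) = y ⬝ᵥ (L *ᵥ y) := by
    have : (L *ᵥ y) = y ᵥ* L := by rw [← mulVec_transpose, hL]
    rw [show (L *ᵥ y) ⬝ᵥ (X *ᵥ (L *ᵥ y)) = (y ᵥ* L) ⬝ᵥ (X *ᵥ (L *ᵥ y)) by rw [← this],
      ← dotProduct_mulVec, mulVec_mulVec, mulVec_mulVec, h.1]
  rw [hy] at k1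
  simp [mulVec_sub, sub_dotProduct, dotProduct_sub] at k1
  unfold resDist
  linarith

/-- The vector of resistances in the cycle. -/
noncomputable def cycF (n : ℕ) (x : Fin n) : ℝ := (x.val : ℝ) * ((n : ℝ) - x.val) / n

theorem cycF_neg (m : ℕ) (x : Fin (m + 2)) : cycF (m + 2) (-x) = cycF (m + 2) x := by
  unfold cycF
  rw [Fin.val_neg]
  split_ifs with h
  · simp [h]
  · rw [Nat.cast_sub x.2.le]
    ring

theorem cycF_lap (m : ℕ) (x : Fin (m + 2)) :
    2 * cycF (m + 2) x - (cycF (m + 2) (x - 1) + cycF (m + 2) (x + 1)) =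
      2 / ((m + 2 : ℕ) : ℝ) - 2 * (if x = 0 then 1 else 0) := by
  have hn : ((m : ℝ) + 2) ≠ 0 := by positivity
  by_cases h0 : x = 0
  · subst h0
    have := cycF_neg m 1
    rw [zero_sub, zero_add, this]
    unfold cycF
    simp
    field_simp
    ring
  · have hx : 0 < x.val := Nat.pos_of_ne_zero (fun h => h0 (Fin.ext h))
    have h1 : ((x - 1 : Fin (m + 2)).val : ℝ) = x.val - 1 := by
      rw [Fin.val_sub_one_of_ne_zero h0, Nat.cast_sub hx]; simp
    by_cases hl : x = Fin.last (m + 1)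
    · have h2 : (x + 1).val = 0 := by rw [hl]; simp
      have h3 : (x.val : ℝ) = m + 1 := by rw [hl]; simp
      unfold cycF
      rw [h1, h2, h3]
      simp [h0]
      field_simp
      ring
    · have h2 : (x + 1).val = x.val + 1 := Fin.val_add_one_of_lt (Fin.lt_last_iff_ne_last.2 hl)
      unfold cycF
      rw [h1, h2]
      simp [h0]
      field_simp
      ring

theorem cyc_lap_mulVec (m : ℕ) (j : Fin (m + 3)) (k : Fin (m + 3)) :
    ((SimpleGraph.cycleGraph (m + 3)).lapMatrix ℝ *ᵥ (fun k => cycF (m + 3) (k - j))) k =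
      2 / ((m + 3 : ℕ) : ℝ) - 2 * (if k = j then 1 else 0) := by
  rw [SimpleGraph.lapMatrix_mulVec_apply, SimpleGraph.cycleGraph_degree_three_le,
    SimpleGraph.cycleGraph_neighborFinset, Finset.sum_pair]
  · have := cycF_lap (m + 1) (k - j)
    simp only [sub_eq_zero] at this
    rw [← this]
    have e1 : k - 1 - j = k - j - 1 := by abel
    have e2 : k + 1 - j = k - j + 1 := by abel
    rw [e1, e2]
    norm_num
  · intro h
    have h2 : (1 : Fin (m + 3)) + 1 = 0 := by
      have : k + (1 + 1) = k + 0 := by rw [← add_assoc, ← h]; abel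
      exact add_left_cancel this
    have := congrArg Fin.val h2
    simp [Fin.val_add] at this
    rw [Nat.mod_eq_of_lt (by omega)] at this
    omega

theorem cyc_resDist (m : ℕ) (X : Matrix (Fin (m + 3)) (Fin (m + 3)) ℝ)
    (h : IsMoorePenroseInv ((SimpleGraph.cycleGraph (m + 3)).lapMatrix ℝ) X)
    (i j : Fin (m + 3)) : resDist X i j = cycF (m + 3) (i - j) := by
  rw [resDist_of_solve (SimpleGraph.isSymm_lapMatrix _ _) h i j
    ((1 / 2 : ℝ) • ((fun k => cycF (m + 3) (k - j)) - (fun k => cycF (m + 3) (k - i))))]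
  · have := cycF_neg (m + 1) (i - j)
    rw [neg_sub] at this
    have z : cycF (m + 3) 0 = 0 := by simp [cycF]
    simp only [Pi.smul_apply, Pi.sub_apply, sub_self, smul_eq_mul]
    rw [this, z]
    ring
  · rw [mulVec_smul, mulVec_sub]
    ext k
    simp only [Pi.smul_apply, Pi.sub_apply, smul_eq_mul, cyc_lap_mulVec, Pi.single_apply]
    ring

theorem sum_sq_aux (N : ℝ) (n : ℕ) :
    ∑ j ∈ Finset.range n, (j : ℝ) * (N - j) = N * (n * (n - 1) / 2) - n * (n - 1) * (2 * n - 1) / 6 := by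
  induction n with
  | zero => simp
  | succ k ih => rw [Finset.sum_range_succ, ih]; push_cast; ring

theorem cycF_sum (n : ℕ) (hn : 0 < n) : ∑ x, cycF n x = ((n : ℝ) ^ 2 - 1) / 6 := by
  unfold cycF
  rw [Fin.sum_univ_eq_sum_range (fun j => (j : ℝ) * ((n : ℝ) - j) / n), ← Finset.sum_div,
    sum_sq_aux]
  have : (n : ℝ) ≠ 0 := by positivity
  field_simp
  ring

theorem cyc_resTrans (m : ℕ) (X : Matrix (Fin (m + 3)) (Fin (m + 3)) ℝ)
    (h : IsMoorePenroseInv ((SimpleGraph.cycleGraph (m + 3)).lapMatrix ℝ) X)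
    (v : Fin (m + 3)) : resTrans X v = (((m + 3 : ℕ) : ℝ) ^ 2 - 1) / 6 := by
  unfold resTrans
  simp only [cyc_resDist m X h]
  rw [← cycF_sum (m + 3) (by omega)]
  exact Equiv.sum_comp (Equiv.subRight v) (cycF (m + 3))

theorem cyc_resMatrix (m : ℕ) (X : Matrix (Fin (m + 3)) (Fin (m + 3)) ℝ)
    (h : IsMoorePenroseInv ((SimpleGraph.cycleGraph (m + 3)).lapMatrix ℝ) X) :
    resMatrix X = circulant (cycF (m + 3)) := by
  ext i j
  simp only [resMatrix, of_apply, circulant_apply, cyc_resDist m X h]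
  split_ifs with hij
  · simp [hij, cycF]
  · rfl

theorem cyc_dft (m : ℕ) (ω : ℂ) (hω : ω ^ (m + 3) = 1) (i k : Fin (m + 3)) :
    ∑ j, (cycF (m + 3) (i - j) : ℂ) * (ω ^ (j : ℕ)) ^ (k : ℕ) =
      (ω ^ (i : ℕ)) ^ (k : ℕ) * ∑ j ∈ Finset.Ico 1 (m + 3),
        ((j : ℂ) * (((m + 3 : ℕ) : ℂ) - j) / ((m + 3 : ℕ) : ℂ)) * (ω ^ (k : ℕ)) ^ j := by
  rw [← Equiv.sum_comp (Equiv.addRight i)]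
  have h1 : ∀ x : Fin (m + 3), (cycF (m + 3) (i - Equiv.addRight i x) : ℂ) *
      (ω ^ ((Equiv.addRight i x : Fin (m + 3)) : ℕ)) ^ (k : ℕ) =
      (ω ^ (i : ℕ)) ^ (k : ℕ) * ((((x : ℕ) : ℂ) * (((m + 3 : ℕ) : ℂ) - (x : ℕ)) / ((m + 3 : ℕ) : ℂ))
        * (ω ^ (k : ℕ)) ^ (x : ℕ)) := by
    intro x
    have e : i - (x + i) = -x := by abel
    rw [Equiv.coe_addRight, e, cycF_neg (m + 1), Fin.val_add, ← pow_eq_pow_mod _ hω]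
    simp only [cycF]
    push_cast
    rw [pow_add, mul_pow, ← pow_mul ω k, mul_comm (k : ℕ), pow_mul ω x]
    ring
  rw [Finset.sum_congr rfl (fun x _ => h1 x), ← Finset.mul_sum]
  congr 1
  rw [Fin.sum_univ_eq_sum_range (fun x => (((x : ℂ) * (((m + 3 : ℕ) : ℂ) - x) / ((m + 3 : ℕ) : ℂ))
        * (ω ^ (k : ℕ)) ^ x)), Finset.range_eq_Ico, Finset.sum_eq_sum_Ico_succ_bot (by omega)]
  simp

theorem charpoly_of_intertwine {n : ℕ} (A W : Matrix (Fin n) (Fin n) ℂ) (d : Fin n → ℂ)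
    (hW : IsUnit W.det) (h : A * W = W * diagonal d) :
    A.charpoly = ∏ i, (X - C (d i)) := by
  have : A = W * diagonal d * W⁻¹ := by
    rw [← h, Matrix.mul_assoc, mul_nonsing_inv _ hW, Matrix.mul_one]
  rw [this, charpoly_mul_comm, ← Matrix.mul_assoc, nonsing_inv_mul _ hW, Matrix.one_mul,
    charpoly_diagonal]

theorem resLap_cycleGraph_eigenvalues (n : ℕ) (hn : 3 ≤ n)
    (Ldag : Matrix (Fin n) (Fin n) ℝ)
    (hpen : IsMoorePenroseInv ((SimpleGraph.cycleGraph n).lapMatrix ℝ) Ldag)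
    (ω : ℂ) (hω : ω = Complex.exp (2 * Real.pi * Complex.I / n))
    (g : ℂ → ℂ)
    (hg : ∀ lam : ℂ, g lam = ∑ j ∈ Finset.Ico 1 n, ((j : ℂ) * ((n : ℂ) - j) / n) * lam ^ j) :
    ((resLap Ldag).map (Complex.ofReal ·)).charpoly =
      ∏ k ∈ Finset.range n, (X - C (((n : ℂ) ^ 2 - 1) / 6 - g (ω ^ k))) ∧
    ((resSignlessLap Ldag).map (Complex.ofReal ·)).charpoly =
      ∏ k ∈ Finset.range n, (X - C (((n : ℂ) ^ 2 - 1) / 6 + g (ω ^ k))) := by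
  obtain ⟨m, rfl⟩ : ∃ m, n = m + 3 := ⟨n - 3, by omega⟩
  have hprim : IsPrimitiveRoot ω (m + 3) := by
    rw [hω]
    exact Complex.isPrimitiveRoot_exp (m + 3) (by omega)
  have hdet : IsUnit (vandermonde (fun i : Fin (m + 3) => ω ^ (i : ℕ))).det := by
    rw [isUnit_iff_ne_zero, det_vandermonde_ne_zero_iff]
    intro a b hab
    exact Fin.ext (hprim.pow_inj a.2 b.2 hab)
  have hR : (circulant (cycF (m + 3))).map (Complex.ofReal ·) *
      vandermonde (fun i : Fin (m + 3) => ω ^ (i : ℕ)) =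
      vandermonde (fun i : Fin (m + 3) => ω ^ (i : ℕ)) *
        diagonal (fun k : Fin (m + 3) => g (ω ^ (k : ℕ))) := by
    ext i k
    rw [mul_diagonal, mul_apply, hg]
    exact cyc_dft m ω hprim.pow_eq_one i k
  have hT : (diagonal (resTrans Ldag)).map (Complex.ofReal ·) =
      ((((m + 3 : ℕ) : ℂ) ^ 2 - 1) / 6) • (1 : Matrix (Fin (m + 3)) (Fin (m + 3)) ℂ) := by
    ext i j
    simp only [map_apply, diagonal_apply, Matrix.smul_apply, one_apply, cyc_resTrans m Ldag hpen]
    split_ifs <;> simp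
  constructor
  · rw [← Fin.prod_univ_eq_prod_range
      (fun k => X - C ((((m + 3 : ℕ) : ℂ) ^ 2 - 1) / 6 - g (ω ^ k)))]
    refine charpoly_of_intertwine _ (vandermonde (fun i : Fin (m + 3) => ω ^ (i : ℕ))) _ hdet ?_
    have : (resLap Ldag).map (Complex.ofReal ·) =
        (diagonal (resTrans Ldag)).map (Complex.ofReal ·) -
          (circulant (cycF (m + 3))).map (Complex.ofReal ·) := by
      rw [resLap, cyc_resMatrix m Ldag hpen]
      ext i j
      simp only [map_apply, Matrix.sub_apply, Matrix.add_apply, Complex.ofReal_sub, Complex.ofReal_add]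
    rw [this, hT, Matrix.sub_mul, hR]
    ext i k
    simp only [Matrix.sub_apply, smul_mul, Matrix.one_mul, mul_diagonal, Matrix.smul_apply, smul_eq_mul]
    ring
  · rw [← Fin.prod_univ_eq_prod_range
      (fun k => X - C ((((m + 3 : ℕ) : ℂ) ^ 2 - 1) / 6 + g (ω ^ k)))]
    refine charpoly_of_intertwine _ (vandermonde (fun i : Fin (m + 3) => ω ^ (i : ℕ))) _ hdet ?_
    have : (resSignlessLap Ldag).map (Complex.ofReal ·) =
        (diagonal (resTrans Ldag)).map (Complex.ofReal ·) +
          (circulant (cycF (m + 3))).map (Complex.ofReal ·) := by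
      rw [resSignlessLap, cyc_resMatrix m Ldag hpen]
      ext i j
      simp only [map_apply, Matrix.sub_apply, Matrix.add_apply, Complex.ofReal_sub, Complex.ofReal_add]
    rw [this, hT, Matrix.add_mul, hR]
    ext i k
    simp only [Matrix.add_apply, smul_mul, Matrix.one_mul, mul_diagonal, Matrix.smul_apply, smul_eq_mul]
    ring
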